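/- Let X be a real Banach space, C ⊆ X a generalized polyhedral convex set, and f : X → ℝ a continuously Fréchet differentiable (C¹) function. Suppose x̄ is a local minimum of f on C and there exist ℓ > 0 and a neighborhood U of x̄ such that ‖∇f(x) − ∇f(x̄)‖ ≤ ℓ‖x − x̄‖ for all x ∈ U. Then ⟨∇f(x̄), u⟩ ≥ 0 for all u in the contingent cone T_C(x̄); moreover, for every v with v ∈ T_C(x̄), −v ∈ T_C(x̄) and ⟨∇f(x̄), v⟩ = 0, one has ⟨∇f(x̄), w⟩ ≥ 0 for all w in the second-order tangent set T²_C(x̄, v), and ⟨z, v⟩ ≥ 0 for every z in the Fréchet second-order subdifferential ∂̂²f(x̄)(v). -/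

import Mathlib

open Filter Topology

/-- The contingent (Bouligand) cone to `C` at `xb`. -/
def contingentCone {X : Type*} [NormedAddCommGroup X] [NormedSpace ℝ X]
    (C : Set X) (xb : X) : Set X :=
  {v | ∃ τ : ℕ → ℝ, ∃ vk : ℕ → X,
    (∀ k, 0 < τ k) ∧ Tendsto τ atTop (𝓝 0) ∧ Tendsto vk atTop (𝓝 v) ∧
    ∀ k, xb + τ k • vk k ∈ C}

/-- The second-order tangent set to `C` at `xb` in direction `v`. -/
def secondOrderTangentSet {X : Type*} [NormedAddCommGroup X] [NormedSpace ℝ X]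
    (C : Set X) (xb v : X) : Set X :=
  {w | ∃ τ : ℕ → ℝ, ∃ wk : ℕ → X,
    (∀ k, 0 < τ k) ∧ Tendsto τ atTop (𝓝 0) ∧ Tendsto wk atTop (𝓝 w) ∧
    ∀ k, xb + τ k • v + ((τ k) ^ 2 / 2) • wk k ∈ C}

/-- `D` is a generalized polyhedral convex set. -/
def IsGPCS {X : Type*} [NormedAddCommGroup X] [NormedSpace ℝ X] (D : Set X) : Prop :=
  ∃ (p : ℕ) (xs : Fin p → (X →L[ℝ] ℝ)) (α : Fin p → ℝ) (L : AffineSubspace ℝ X),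
    IsClosed (L : Set X) ∧ D = {x | x ∈ L ∧ ∀ i, xs i x ≤ α i}

/-- The Fréchet second-order subdifferential of `f` at `xb` (relative to `∇f(xb)`),
applied to the direction `v` (with `X` canonically embedded in `X**`):
`z ∈ ∂̂²f(xb)(v)` iff
`limsup_{x → xb} [⟨z, x − xb⟩ − ⟨∇f(x) − ∇f(xb), v⟩]/(‖x − xb‖ + ‖∇f(x) − ∇f(xb)‖) ≤ 0`. -/
def frechetSecondOrderSubdiff {X : Type*} [NormedAddCommGroup X] [NormedSpace ℝ X]
    (f : X → ℝ) (xb : X) (v : X) : Set (X →L[ℝ] ℝ) :=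
  {z | Filter.limsup (fun x =>
      (z (x - xb) - (fderiv ℝ f x - fderiv ℝ f xb) v) /
        (‖x - xb‖ + ‖fderiv ℝ f x - fderiv ℝ f xb‖)) (𝓝[≠] xb) ≤ 0}

theorem aux_dir {X : Type*} [NormedAddCommGroup X] [NormedSpace ℝ X]
    (C : Set X) (hC : IsGPCS C) (xb : X) (hxb : xb ∈ C) (u : X) (hu : u ∈ contingentCone C xb) :
    ∀ᶠ t : ℝ in 𝓝[>] 0, xb + t • u ∈ C := by
  obtain ⟨p, xs, α, L, hL, rfl⟩ := hC
  obtain ⟨τ, vk, hτ, -, hvk, hmem⟩ := hu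
  obtain ⟨hxL, hxi⟩ := hxb
  have hdir : u ∈ L.direction := by
    have hcl : IsClosed (L.direction : Set X) := (AffineSubspace.isClosed_direction_iff L).2 hL
    refine hcl.mem_of_tendsto hvk (Eventually.of_forall fun k => ?_)
    have h1 := AffineSubspace.vsub_mem_direction (hmem k).1 hxL
    have h2 := L.direction.smul_mem (τ k)⁻¹ h1
    have : (τ k)⁻¹ • (xb + τ k • vk k -ᵥ xb) = vk k := by
      rw [vsub_eq_sub, add_sub_cancel_left, smul_smul, inv_mul_cancel₀ (hτ k).ne', one_smul]
    rw [this] at h2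
    exact h2
  have hall : ∀ i, ∀ᶠ t : ℝ in 𝓝[>] 0, xs i (xb + t • u) ≤ α i := by
    intro i
    rcases (hxi i).lt_or_eq with h | h
    · have hc : ContinuousAt (fun t : ℝ => xs i (xb + t • u)) 0 := by fun_prop
      have : ∀ᶠ t : ℝ in 𝓝 0, xs i (xb + t • u) < α i :=
        hc.eventually_lt continuousAt_const (by simpa using h)
      exact (this.filter_mono nhdsWithin_le_nhds).mono fun t ht => ht.le
    · have hle : xs i u ≤ 0 := by
        refine le_of_tendsto (((xs i).continuous.tendsto u).comp hvk)
          (Eventually.of_forall fun k => ?_)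
        have h1 := (hmem k).2 i
        rw [map_add, map_smul, h, smul_eq_mul] at h1
        have h3 := hτ k
        simp only [Function.comp]
        by_contra hcon
        push Not at hcon
        nlinarith [mul_pos h3 hcon]
      filter_upwards [self_mem_nhdsWithin] with t ht
      rw [map_add, map_smul, h, smul_eq_mul]
      have : (0:ℝ) < t := ht
      nlinarith [mul_nonneg this.le (neg_nonneg.2 hle)]
  filter_upwards [eventually_all.2 hall] with t ht
  refine ⟨?_, ht⟩
  rw [add_comm]
  exact AffineSubspace.vadd_mem_of_mem_direction (L.direction.smul_mem t hdir) hxL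

theorem aux_convex {X : Type*} [NormedAddCommGroup X] [NormedSpace ℝ X]
    (C : Set X) (hC : IsGPCS C) : Convex ℝ C := by
  obtain ⟨p, xs, α, L, hL, rfl⟩ := hC
  intro x hx y hy a b ha hb hab
  refine ⟨L.convex hx.1 hy.1 ha hb hab, fun i => ?_⟩
  have h1 := mul_le_mul_of_nonneg_left (hx.2 i) ha
  have h2 := mul_le_mul_of_nonneg_left (hy.2 i) hb
  have h3 : a * α i + b * α i = α i := by rw [← add_mul, hab, one_mul]
  simp only [map_add, map_smul, smul_eq_mul]
  linarith

theorem aux_deriv {X : Type*} [NormedAddCommGroup X] [NormedSpace ℝ X]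
    (f : X → ℝ) (hf : Differentiable ℝ f) (x u : X) (t : ℝ) :
    HasDerivAt (fun t : ℝ => f (x + t • u)) (fderiv ℝ f (x + t • u) u) t := by
  have h1 : HasDerivAt (fun t : ℝ => x + t • u) u t := by
    simpa using ((hasDerivAt_id t).smul_const u).const_add x
  exact (hf (x + t • u)).hasFDerivAt.comp_hasDerivAt t h1

theorem aux_min {X : Type*} [NormedAddCommGroup X] [NormedSpace ℝ X]
    (C : Set X) (hC : IsGPCS C) (f : X → ℝ) (xb : X) (hxb : xb ∈ C)
    (hmin : ∃ ε > 0, ∀ x ∈ C, ‖x - xb‖ ≤ ε → f xb ≤ f x)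
    (u : X) (hu : u ∈ contingentCone C xb) :
    ∀ᶠ t : ℝ in 𝓝[>] 0, f xb ≤ f (xb + t • u) := by
  obtain ⟨ε, hε, hm⟩ := hmin
  have hc : ContinuousAt (fun t : ℝ => ‖(xb + t • u) - xb‖) 0 := by fun_prop
  have : ∀ᶠ t : ℝ in 𝓝 0, ‖(xb + t • u) - xb‖ < ε :=
    hc.eventually_lt continuousAt_const (by simpa using hε)
  filter_upwards [aux_dir C hC xb hxb u hu, this.filter_mono nhdsWithin_le_nhds] with t h1 h2
  exact hm _ h1 h2.le

theorem aux_first {X : Type*} [NormedAddCommGroup X] [NormedSpace ℝ X]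
    (C : Set X) (hC : IsGPCS C) (f : X → ℝ) (hf : Differentiable ℝ f) (xb : X) (hxb : xb ∈ C)
    (hmin : ∃ ε > 0, ∀ x ∈ C, ‖x - xb‖ ≤ ε → f xb ≤ f x)
    (u : X) (hu : u ∈ contingentCone C xb) : 0 ≤ fderiv ℝ f xb u := by
  have hd := aux_deriv f hf xb u 0
  rw [zero_smul, add_zero, hasDerivAt_iff_tendsto_slope] at hd
  have hd' := hd.mono_left (nhdsWithin_mono (0:ℝ)
    (show Set.Ioi (0:ℝ) ⊆ {0}ᶜ from fun t ht => (ne_of_gt ht)))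
  refine ge_of_tendsto hd' ?_
  filter_upwards [aux_min C hC f xb hxb hmin u hu, self_mem_nhdsWithin] with t h1 h2
  have h2' : (0:ℝ) < t := h2
  rw [slope_def_field]
  simp only [zero_smul, add_zero, sub_zero]
  exact div_nonneg (sub_nonneg.2 h1) h2'.le

theorem aux_second {X : Type*} [NormedAddCommGroup X] [NormedSpace ℝ X]
    (C : Set X) (hC : IsGPCS C) (xb : X) (hxb : xb ∈ C) (v : X)
    (hv : -v ∈ contingentCone C xb) (w : X) (hw : w ∈ secondOrderTangentSet C xb v) :
    w ∈ contingentCone C xb := by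
  obtain ⟨τ, wk, hτ, hτ0, hwk, hmem⟩ := hw
  have hτ' : Tendsto τ atTop (𝓝[>] 0) :=
    tendsto_nhdsWithin_iff.2 ⟨hτ0, Eventually.of_forall hτ⟩
  obtain ⟨N, hN⟩ := eventually_atTop.1 (hτ'.eventually (aux_dir C hC xb hxb _ hv))
  refine ⟨fun k => (τ (k + N)) ^ 2 / 4, fun k => wk (k + N), fun k => ?_, ?_, ?_, fun k => ?_⟩
  · have := hτ (k + N); positivity
  · have := ((hτ0.comp (tendsto_add_atTop_nat N)).pow 2).div_const 4
    simpa using this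
  · exact hwk.comp (tendsto_add_atTop_nat N)
  · have h1 := hN (k + N) (Nat.le_add_left _ _)
    have h2 := hmem (k + N)
    have h3 := aux_convex C hC h1 h2 (a := 1/2) (b := 1/2) (by norm_num) (by norm_num)
      (by norm_num)
    convert h3 using 1
    module

theorem aux_third {X : Type*} [NormedAddCommGroup X] [NormedSpace ℝ X]
    (C : Set X) (hC : IsGPCS C) (f : X → ℝ) (hf : Differentiable ℝ f) (xb : X) (hxb : xb ∈ C)
    (hmin : ∃ ε > 0, ∀ x ∈ C, ‖x - xb‖ ≤ ε → f xb ≤ f x)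
    (ℓ : ℝ) (hℓ : 0 < ℓ) (U : Set X) (hU : U ∈ 𝓝 xb)
    (hlip : ∀ x ∈ U, ‖fderiv ℝ f x - fderiv ℝ f xb‖ ≤ ℓ * ‖x - xb‖)
    (v : X) (hv : -v ∈ contingentCone C xb) (hv0 : fderiv ℝ f xb v = 0)
    (z : X →L[ℝ] ℝ) (hz : z ∈ frechetSecondOrderSubdiff f xb v) : 0 ≤ z v := by
  by_contra hneg
  push Not at hneg
  have hvne : v ≠ 0 := by rintro rfl; simp at hneg
  have hvpos : 0 < ‖v‖ := norm_pos_iff.2 hvne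
  set ε : ℝ := -z v / (2 * ((1 + ℓ) * ‖v‖)) with hεdef
  have hden : 0 < 2 * ((1 + ℓ) * ‖v‖) := by positivity
  have hε : 0 < ε := div_pos (by linarith) hden
  have hεm : ε * (2 * ((1 + ℓ) * ‖v‖)) = -z v := div_mul_cancel₀ _ hden.ne'
  have hbdd : IsBoundedUnder (· ≤ ·) (𝓝[≠] xb) (fun x =>
      (z (x - xb) - (fderiv ℝ f x - fderiv ℝ f xb) v) /
        (‖x - xb‖ + ‖fderiv ℝ f x - fderiv ℝ f xb‖)) := by
    refine isBoundedUnder_of ⟨‖z‖ + ‖v‖, fun x => ?_⟩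
    refine div_le_of_le_mul₀ (by positivity) (by positivity) ?_
    have h1 := (le_abs_self _).trans (z.le_opNorm (x - xb))
    have h2 := (neg_le_abs _).trans ((fderiv ℝ f x - fderiv ℝ f xb).le_opNorm v)
    have h3 : 0 ≤ ‖z‖ * ‖fderiv ℝ f x - fderiv ℝ f xb‖ := by positivity
    have h4 : 0 ≤ ‖v‖ * ‖x - xb‖ := by positivity
    nlinarith
  have hev := eventually_lt_of_limsup_lt (lt_of_le_of_lt hz hε) hbdd
  have hten : Tendsto (fun t : ℝ => xb + t • (-v)) (𝓝[>] 0) (𝓝[≠] xb) := by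
    refine tendsto_nhdsWithin_iff.2 ⟨?_, ?_⟩
    · have hc : ContinuousAt (fun t : ℝ => xb + t • (-v)) 0 := by fun_prop
      have := hc.tendsto
      simp only [zero_smul, add_zero] at this
      exact this.mono_left nhdsWithin_le_nhds
    · filter_upwards [self_mem_nhdsWithin] with t ht
      have ht' : (0:ℝ) < t := ht
      simp [ht'.ne', hvne]
  have hD : ∀ᶠ t : ℝ in 𝓝[>] 0, fderiv ℝ f (xb + t • (-v)) (-v) < 0 := by
    filter_upwards [hten.eventually hev, self_mem_nhdsWithin,
      (hten.mono_right nhdsWithin_le_nhds).eventually hU] with t h1 h2 h3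
    have ht : (0:ℝ) < t := h2
    have hl := hlip _ h3
    have hn : ‖xb + t • (-v) - xb‖ = t * ‖v‖ := by
      rw [add_sub_cancel_left, norm_smul, norm_neg, Real.norm_of_nonneg ht.le]
    rw [div_lt_iff₀ (by rw [hn]; positivity)] at h1
    rw [hn] at h1 hl
    have e1 : z (xb + t • (-v) - xb) = -(t * z v) := by
      rw [add_sub_cancel_left, map_smul, map_neg, smul_eq_mul, mul_neg]
    rw [e1, ContinuousLinearMap.sub_apply, hv0] at h1
    rw [map_neg]
    have h5 := mul_le_mul_of_nonneg_left hl hε.le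
    have h6 : t * (ε * (2 * ((1 + ℓ) * ‖v‖))) = t * (-z v) := by rw [hεm]
    have h7 : 0 < t * -z v := mul_pos ht (by linarith)
    nlinarith
  obtain ⟨δ, hδ, hδs⟩ := mem_nhdsGT_iff_exists_Ioo_subset.1 hD
  have hδ' : (0:ℝ) < δ := hδ
  have hanti : StrictAntiOn (fun t : ℝ => f (xb + t • (-v))) (Set.Ico 0 δ) := by
    refine strictAntiOn_of_deriv_neg (convex_Ico 0 δ) ?_ ?_
    · exact fun t _ => (aux_deriv f hf xb (-v) t).continuousAt.continuousWithinAt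
    · intro t ht
      rw [interior_Ico] at ht
      rw [(aux_deriv f hf xb (-v) t).deriv]
      exact hδs ht
  obtain ⟨t, h1, h2⟩ := ((aux_min C hC f xb hxb hmin _ hv).and (Ioo_mem_nhdsGT hδ')).exists
  have := hanti (Set.left_mem_Ico.2 hδ') ⟨h2.1.le, h2.2⟩ h2.1
  simp only [zero_smul, add_zero] at this
  linarith


theorem stmt_9 {X : Type*} [NormedAddCommGroup X] [NormedSpace ℝ X] [CompleteSpace X]
    (C : Set X) (hC : IsGPCS C)
    (f : X → ℝ) (hf : ContDiff ℝ 1 f)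
    (xb : X) (hxb : xb ∈ C)
    (hmin : ∃ ε > 0, ∀ x ∈ C, ‖x - xb‖ ≤ ε → f xb ≤ f x)
    (ℓ : ℝ) (hℓ : 0 < ℓ) (U : Set X) (hU : U ∈ 𝓝 xb)
    (hlip : ∀ x ∈ U, ‖fderiv ℝ f x - fderiv ℝ f xb‖ ≤ ℓ * ‖x - xb‖) :
    (∀ u ∈ contingentCone C xb, 0 ≤ fderiv ℝ f xb u) ∧
    (∀ v : X, v ∈ contingentCone C xb → -v ∈ contingentCone C xb →
      fderiv ℝ f xb v = 0 →
      (∀ w ∈ secondOrderTangentSet C xb v, 0 ≤ fderiv ℝ f xb w) ∧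
      (∀ z ∈ frechetSecondOrderSubdiff f xb v, 0 ≤ z v)) := by
  have hd := hf.differentiable one_ne_zero
  refine ⟨fun u hu => aux_first C hC f hd xb hxb hmin u hu, fun v _ hv' hv0 => ⟨fun w hw => ?_,
    fun z hz => aux_third C hC f hd xb hxb hmin ℓ hℓ U hU hlip v hv' hv0 z hz⟩⟩
  exact aux_first C hC f hd xb hxb hmin w (aux_second C hC xb hxb v hv' w hw)
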